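/- Let p ≥ 5 be a prime with p ≡ 2 (mod 3), and let e ≥ 1. Then the number Θ(p^e) of equivalence classes of 𝔉_{p^e} under the relation ~ satisfies 72·Θ(p^e) = p^{4e} − 10p^{4e−1} + 35p^{4e−2} − 50p^{4e−3} + 24p^{4e−4} + 10p^{2e} − 60p^{2e−1} + 98p^{2e−2}. -/

import Mathlib

open Matrix

/-- `𝔉ₙ`: matrices `A = [[a,b],[c,d]]` over `ℤ/nℤ` with unit determinant `ad - bc` and with
`a, b, c, d, a+b, c+d, a-c, b-d, a+b-c-d` all units of `ℤ/nℤ`. -/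
def Frak (n : ℕ) (A : Matrix (Fin 2) (Fin 2) (ZMod n)) : Prop :=
  IsUnit (A 0 0 * A 1 1 - A 0 1 * A 1 0) ∧
  IsUnit (A 0 0) ∧ IsUnit (A 0 1) ∧ IsUnit (A 1 0) ∧ IsUnit (A 1 1) ∧
  IsUnit (A 0 0 + A 0 1) ∧ IsUnit (A 1 0 + A 1 1) ∧
  IsUnit (A 0 0 - A 1 0) ∧ IsUnit (A 0 1 - A 1 1) ∧
  IsUnit (A 0 0 + A 0 1 - A 1 0 - A 1 1)

/-- The matrix `M₁ = [[-1,1],[-1,0]]` as an element of `GL₂(ℤ/nℤ)`. -/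
noncomputable def M1 (n : ℕ) : GL (Fin 2) (ZMod n) :=
  Matrix.nonsingInvUnit !![-1, 1; -1, 0] (by simp [Matrix.det_fin_two_of])

/-- The matrix `M₂ = [[0,1],[1,0]]` as an element of `GL₂(ℤ/nℤ)`. -/
noncomputable def M2 (n : ℕ) : GL (Fin 2) (ZMod n) :=
  Matrix.nonsingInvUnit !![0, 1; 1, 0] (by simp [Matrix.det_fin_two_of])

/-- The copy of `S₃` inside `GL₂(ℤ/nℤ)` generated by `M₁` and `M₂`. -/
noncomputable def Sgrp (n : ℕ) : Subgroup (GL (Fin 2) (ZMod n)) :=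
  Subgroup.closure {M1 n, M2 n}

/-- The relation `A ~ B` on matrices over `ℤ/nℤ`: `B = Q·A·P` or `B = Q·A⁻¹·P`
for some `P, Q` in the copy `S` of `S₃`. -/
noncomputable def BRel (n : ℕ) (A B : Matrix (Fin 2) (Fin 2) (ZMod n)) : Prop :=
  ∃ P Q : GL (Fin 2) (ZMod n), P ∈ Sgrp n ∧ Q ∈ Sgrp n ∧
    (B = (Q : Matrix (Fin 2) (Fin 2) (ZMod n)) * A * (P : Matrix (Fin 2) (Fin 2) (ZMod n)) ∨
     B = (Q : Matrix (Fin 2) (Fin 2) (ZMod n)) * A⁻¹ * (P : Matrix (Fin 2) (Fin 2) (ZMod n)))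

/-- `Θ(n)`: the number of equivalence classes of `𝔉ₙ` under `~`. -/
noncomputable def Theta (n : ℕ) : ℕ :=
  Nat.card (Quot (fun A B : {A : Matrix (Fin 2) (Fin 2) (ZMod n) // Frak n A} => BRel n A.1 B.1))

section Burnside

variable {Γ H : Type*} [Group Γ] [Group H]

/-- The action of `ℤˣ` on `H × H` exchanging the two factors. -/
def unitsSwap (H : Type*) [Group H] : ℤˣ →* MulAut (H × H) where
  toFun t := if t = 1 then 1 else MulEquiv.prodComm
  map_one' := by simp
  map_mul' s t := by
    rcases Int.units_eq_one_or s with rfl | rfl <;> rcases Int.units_eq_one_or t with rfl | rfl <;>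
      ext x <;> simp

/-- The wreath product of `H` with a group of order two. -/
abbrev WreathTwo (H : Type*) [Group H] := (H × H) ⋊[unitsSwap H] ℤˣ

/-- The action of the wreath product on a subset of a group, by two-sided multiplication through
`ρ` and by inversion. -/
@[reducible]
def wreathAction (ρ : H →* Γ) (X : Set Γ) (hmul : ∀ h k, ∀ A ∈ X, ρ h * A * ρ k ∈ X)
    (hinv : ∀ A ∈ X, A⁻¹ ∈ X) : MulAction (WreathTwo H) X where
  smul g A := ⟨ρ g.left.1 * (A : Γ) ^ (g.right : ℤ) * ρ (g.left.2)⁻¹, hmul _ _ _ (by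
    rcases Int.units_eq_one_or g.right with h | h <;> simp [h, hinv])⟩
  one_smul A := Subtype.ext (by
    change ρ 1 * (A : Γ) ^ (1 : ℤ) * ρ (1)⁻¹ = A
    simp)
  mul_smul g g' A := Subtype.ext (by
    obtain ⟨⟨h, k⟩, s⟩ := g
    obtain ⟨⟨h', k'⟩, t⟩ := g'
    change ρ (h * (unitsSwap H s (h', k')).1) * (A : Γ) ^ ((s * t : ℤˣ) : ℤ) *
      ρ (k * (unitsSwap H s (h', k')).2)⁻¹ =
      ρ h * (ρ h' * (A : Γ) ^ (t : ℤ) * ρ (k')⁻¹) ^ (s : ℤ) * ρ k⁻¹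
    rcases Int.units_eq_one_or s with rfl | rfl <;> rcases Int.units_eq_one_or t with rfl | rfl <;>
      simp [unitsSwap, mul_assoc])

/-- Burnside's lemma for two-sided multiplication and inversion. -/
theorem card_quot_two_sided_mul_inv [Fintype H] (ρ : H →* Γ) (X : Set Γ) [Finite X]
    (hmul : ∀ h k, ∀ A ∈ X, ρ h * A * ρ k ∈ X) (hinv : ∀ A ∈ X, A⁻¹ ∈ X) :
    2 * Fintype.card H ^ 2 * Nat.card (Quot fun A B : X => ∃ h k,
        (B : Γ) = ρ h * A * ρ k ∨ (B : Γ) = ρ h * (A : Γ)⁻¹ * ρ k) =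
      ∑ h, ∑ k, Nat.card {A : X // ρ h * (A : Γ) = A * ρ k} +
        Fintype.card H * ∑ h, Nat.card {A : X // (A : Γ) * A = ρ h} := by
  classical
  let _ := wreathAction ρ X hmul hinv
  let _ : Fintype X := Fintype.ofFinite X
  let _ : Fintype (WreathTwo H) := Fintype.ofEquiv _ SemidirectProduct.equivProd.symm
  have hsmul (h k : H) (t : ℤˣ) (A : X) :
      (((⟨(h, k), t⟩ : WreathTwo H) • A : X) : Γ) = ρ h * (A : Γ) ^ (t : ℤ) * ρ k⁻¹ := rfl
  have hq : Nat.card (Quot fun A B : X => ∃ h k,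
        (B : Γ) = ρ h * A * ρ k ∨ (B : Γ) = ρ h * (A : Γ)⁻¹ * ρ k) =
      Fintype.card (MulAction.orbitRel.Quotient (WreathTwo H) X) := by
    rw [← Nat.card_eq_fintype_card]
    refine Nat.card_congr (Quot.congrRight fun A B => ?_)
    rw [← Setoid.comm', MulAction.orbitRel_apply, MulAction.mem_orbit_iff]
    constructor
    · rintro ⟨h, k, e | e⟩
      · exact ⟨⟨(h, k⁻¹), 1⟩, Subtype.ext (by simp [hsmul, e])⟩
      · exact ⟨⟨(h, k⁻¹), -1⟩, Subtype.ext (by simp [hsmul, e])⟩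
    · rintro ⟨⟨⟨h, k⟩, t⟩, e⟩
      refine ⟨h, k⁻¹, ?_⟩
      rw [← e, hsmul]
      rcases Int.units_eq_one_or t with rfl | rfl <;> simp
  have hcard : Fintype.card (WreathTwo H) = 2 * Fintype.card H ^ 2 := by
    rw [Fintype.card_congr SemidirectProduct.equivProd]
    simp only [Fintype.card_prod, Fintype.card_units_int]
    ring
  have hone (h k : H) : Fintype.card (MulAction.fixedBy X (⟨(h, k), 1⟩ : WreathTwo H)) =
      Nat.card {A : X // ρ h * (A : Γ) = A * ρ k} := by
    rw [← Nat.card_eq_fintype_card]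
    refine Nat.card_congr (Equiv.subtypeEquivRight fun A => ?_)
    rw [MulAction.mem_fixedBy, Subtype.ext_iff, hsmul]
    simp [mul_inv_eq_iff_eq_mul]
  have hneg (h k : H) : Fintype.card (MulAction.fixedBy X (⟨(h, k), -1⟩ : WreathTwo H)) =
      Nat.card {A : X // (A : Γ) * A = ρ (h * k)} := by
    rw [← Nat.card_eq_fintype_card]
    refine Nat.card_congr
      { toFun := fun A => ⟨⟨A.1.1 * ρ k, by simpa using hmul 1 k _ A.1.2⟩, ?_⟩
        invFun := fun B => ⟨⟨B.1.1 * ρ k⁻¹, by simpa using hmul 1 k⁻¹ _ B.1.2⟩, ?_⟩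
        left_inv := fun A => by simp
        right_inv := fun B => by simp }
    · have hA := A.2
      rw [MulAction.mem_fixedBy, Subtype.ext_iff, hsmul] at hA
      change (A.1.1 * ρ k) * (A.1.1 * ρ k) = _
      nth_rewrite 1 [← hA]
      simp [mul_assoc]
    · have hB := B.2
      rw [MulAction.mem_fixedBy, Subtype.ext_iff, hsmul]
      rw [← eq_mul_inv_iff_mul_eq] at hB
      change ρ h * (B.1.1 * ρ k⁻¹) ^ (-1 : ℤ) * ρ k⁻¹ = B.1.1 * ρ k⁻¹
      conv_rhs => rw [hB]
      simp [mul_assoc]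
  rw [hq, ← hcard, mul_comm, ← MulAction.sum_card_fixedBy_eq_card_orbits_mul_card_group,
    ← Equiv.sum_comp SemidirectProduct.equivProd.symm, Fintype.sum_prod_type_right]
  have hu : (Finset.univ : Finset ℤˣ) = {1, -1} := rfl
  rw [hu, Finset.sum_pair (by decide), Fintype.sum_prod_type, Fintype.sum_prod_type]
  congr 1
  · exact Finset.sum_congr rfl fun h _ => Finset.sum_congr rfl fun k _ => hone h k
  · rw [← smul_eq_mul, ← Finset.card_univ, ← Finset.sum_const]
    refine Finset.sum_congr rfl fun h _ => ?_
    rw [← Equiv.sum_comp (Equiv.mulLeft h) fun k => Nat.card {A : X // (A : Γ) * A = ρ k}]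
    exact Finset.sum_congr rfl fun k _ => hneg h k

end Burnside

section Dihedral

/-- The integral representation of the dihedral group of order six underlying `Sgrp`. -/
def dihedralInt : DihedralGroup 3 →* Matrix (Fin 2) (Fin 2) ℤ where
  toFun
    | .r i => !![-1, 1; -1, 0] ^ i.val
    | .sr i => !![0, 1; 1, 0] * !![-1, 1; -1, 0] ^ i.val
  map_one' := rfl
  map_mul' := by decide

/-- The reduction of `dihedralInt` modulo `n`. -/
noncomputable def dihedralRep (n : ℕ) : DihedralGroup 3 →* GL (Fin 2) (ZMod n) :=
  ((Int.castRingHom (ZMod n)).mapMatrix.toMonoidHom.comp dihedralInt).toHomUnits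

theorem coe_dihedralRep (n : ℕ) (h : DihedralGroup 3) :
    (dihedralRep n h : Matrix (Fin 2) (Fin 2) (ZMod n)) =
      (dihedralInt h).map (Int.castRingHom (ZMod n)) := rfl

theorem dihedralRep_r (n : ℕ) : dihedralRep n (.r 1) = M1 n := by
  apply Units.ext
  rw [coe_dihedralRep, show dihedralInt (.r 1) = !![-1, 1; -1, 0] by decide]
  ext i j
  fin_cases i <;> fin_cases j <;> simp [M1, Matrix.nonsingInvUnit]

theorem dihedralRep_sr (n : ℕ) : dihedralRep n (.sr 0) = M2 n := by
  apply Units.ext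
  rw [coe_dihedralRep, show dihedralInt (.sr 0) = !![0, 1; 1, 0] by decide]
  ext i j
  fin_cases i <;> fin_cases j <;> simp [M2, Matrix.nonsingInvUnit]

theorem exists_dihedral_three_eq : ∀ h : DihedralGroup 3, ∃ i : Fin 2, ∃ j : Fin 3,
    h = .sr 0 ^ i.val * .r 1 ^ j.val := by decide

theorem closure_dihedral_three :
    Subgroup.closure {.r 1, .sr 0} = (⊤ : Subgroup (DihedralGroup 3)) := by
  rw [eq_top_iff]
  intro h _
  have hr : DihedralGroup.r 1 ∈ Subgroup.closure {.r 1, (.sr 0 : DihedralGroup 3)} :=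
    Subgroup.subset_closure (by simp)
  have hs : DihedralGroup.sr 0 ∈ Subgroup.closure {.r 1, (.sr 0 : DihedralGroup 3)} :=
    Subgroup.subset_closure (by simp)
  obtain ⟨i, j, rfl⟩ := exists_dihedral_three_eq h
  exact mul_mem (pow_mem hs _) (pow_mem hr _)

theorem range_dihedralRep (n : ℕ) : (dihedralRep n).range = Sgrp n := by
  rw [MonoidHom.range_eq_map, ← closure_dihedral_three, MonoidHom.map_closure, Set.image_pair,
    dihedralRep_r, dihedralRep_sr, Sgrp]

theorem coe_M1 (n : ℕ) : (M1 n : Matrix (Fin 2) (Fin 2) (ZMod n)) = !![-1, 1; -1, 0] := rfl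

theorem coe_M2 (n : ℕ) : (M2 n : Matrix (Fin 2) (Fin 2) (ZMod n)) = !![0, 1; 1, 0] := rfl

theorem IsUnit.of_eq_or_neg {R : Type*} [CommRing R] {x y : R} (hx : IsUnit x)
    (h : y = x ∨ y = -x) : IsUnit y := by
  rcases h with rfl | rfl
  exacts [hx, hx.neg]

theorem Frak.M1_mul {n : ℕ} {A : Matrix (Fin 2) (Fin 2) (ZMod n)} (h : Frak n A) :
    Frak n ((M1 n : Matrix (Fin 2) (Fin 2) (ZMod n)) * A) := by
  obtain ⟨h1, h2, h3, h4, h5, h6, h7, h8, h9, h10⟩ := h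
  simp only [Frak, coe_M1, Matrix.mul_apply, Fin.sum_univ_two, Matrix.of_apply, Matrix.cons_val]
  exact ⟨h1.of_eq_or_neg (by grind), h8.of_eq_or_neg (by grind), h9.of_eq_or_neg (by grind),
    h2.of_eq_or_neg (by grind), h3.of_eq_or_neg (by grind), h10.of_eq_or_neg (by grind),
    h6.of_eq_or_neg (by grind), h4.of_eq_or_neg (by grind), h5.of_eq_or_neg (by grind),
    h7.of_eq_or_neg (by grind)⟩

theorem Frak.mul_M1 {n : ℕ} {A : Matrix (Fin 2) (Fin 2) (ZMod n)} (h : Frak n A) :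
    Frak n (A * (M1 n : Matrix (Fin 2) (Fin 2) (ZMod n))) := by
  obtain ⟨h1, h2, h3, h4, h5, h6, h7, h8, h9, h10⟩ := h
  simp only [Frak, coe_M1, Matrix.mul_apply, Fin.sum_univ_two, Matrix.of_apply, Matrix.cons_val]
  exact ⟨h1.of_eq_or_neg (by grind), h6.of_eq_or_neg (by grind), h2.of_eq_or_neg (by grind),
    h7.of_eq_or_neg (by grind), h4.of_eq_or_neg (by grind), h3.of_eq_or_neg (by grind),
    h5.of_eq_or_neg (by grind), h10.of_eq_or_neg (by grind), h8.of_eq_or_neg (by grind),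
    h9.of_eq_or_neg (by grind)⟩

theorem Frak.M2_mul {n : ℕ} {A : Matrix (Fin 2) (Fin 2) (ZMod n)} (h : Frak n A) :
    Frak n ((M2 n : Matrix (Fin 2) (Fin 2) (ZMod n)) * A) := by
  obtain ⟨h1, h2, h3, h4, h5, h6, h7, h8, h9, h10⟩ := h
  simp only [Frak, coe_M2, Matrix.mul_apply, Fin.sum_univ_two, Matrix.of_apply, Matrix.cons_val]
  exact ⟨h1.of_eq_or_neg (by grind), h4.of_eq_or_neg (by grind), h5.of_eq_or_neg (by grind),
    h2.of_eq_or_neg (by grind), h3.of_eq_or_neg (by grind), h7.of_eq_or_neg (by grind),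
    h6.of_eq_or_neg (by grind), h8.of_eq_or_neg (by grind), h9.of_eq_or_neg (by grind),
    h10.of_eq_or_neg (by grind)⟩

theorem Frak.mul_M2 {n : ℕ} {A : Matrix (Fin 2) (Fin 2) (ZMod n)} (h : Frak n A) :
    Frak n (A * (M2 n : Matrix (Fin 2) (Fin 2) (ZMod n))) := by
  obtain ⟨h1, h2, h3, h4, h5, h6, h7, h8, h9, h10⟩ := h
  simp only [Frak, coe_M2, Matrix.mul_apply, Fin.sum_univ_two, Matrix.of_apply, Matrix.cons_val]
  exact ⟨h1.of_eq_or_neg (by grind), h3.of_eq_or_neg (by grind), h2.of_eq_or_neg (by grind),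
    h5.of_eq_or_neg (by grind), h4.of_eq_or_neg (by grind), h6.of_eq_or_neg (by grind),
    h7.of_eq_or_neg (by grind), h9.of_eq_or_neg (by grind), h8.of_eq_or_neg (by grind),
    h10.of_eq_or_neg (by grind)⟩

theorem Frak.inv {n : ℕ} {A : GL (Fin 2) (ZMod n)} (h : Frak n A) :
    Frak n (A⁻¹ : GL (Fin 2) (ZMod n)) := by
  obtain ⟨h1, h2, h3, h4, h5, h6, h7, h8, h9, h10⟩ := h
  have hd : IsUnit (Ring.inverse (A.val 0 0 * A.val 1 1 - A.val 0 1 * A.val 1 0)) := h1.ringInverse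
  rw [Matrix.coe_units_inv, Matrix.inv_def, Matrix.adjugate_fin_two, Matrix.det_fin_two]
  set δ := Ring.inverse (A.val 0 0 * A.val 1 1 - A.val 0 1 * A.val 1 0)
  simp only [Frak, Matrix.smul_apply, Matrix.of_apply, Matrix.cons_val, smul_eq_mul]
  exact ⟨((hd.mul hd).mul h1).of_eq_or_neg (by grind), (hd.mul h5).of_eq_or_neg (by grind),
    (hd.mul h3).of_eq_or_neg (by grind), (hd.mul h4).of_eq_or_neg (by grind),
    (hd.mul h2).of_eq_or_neg (by grind), (hd.mul h9).of_eq_or_neg (by grind),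
    (hd.mul h8).of_eq_or_neg (by grind), (hd.mul h7).of_eq_or_neg (by grind),
    (hd.mul h6).of_eq_or_neg (by grind), (hd.mul h10).of_eq_or_neg (by grind)⟩

theorem Frak.mul_mul {n : ℕ} {A : GL (Fin 2) (ZMod n)} (h : Frak n A) (x y : DihedralGroup 3) :
    Frak n (dihedralRep n x * A * dihedralRep n y).val := by
  have left₁ (i : ℕ) {B : GL (Fin 2) (ZMod n)} (hB : Frak n B) : Frak n (M1 n ^ i * B).val := by
    induction i with
    | zero => simpa using hB
    | succ i ih => rw [pow_succ', mul_assoc]; exact ih.M1_mul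
  have left₂ (i : ℕ) {B : GL (Fin 2) (ZMod n)} (hB : Frak n B) : Frak n (M2 n ^ i * B).val := by
    induction i with
    | zero => simpa using hB
    | succ i ih => rw [pow_succ', mul_assoc]; exact ih.M2_mul
  have right₁ (i : ℕ) {B : GL (Fin 2) (ZMod n)} (hB : Frak n B) : Frak n (B * M1 n ^ i).val := by
    induction i with
    | zero => simpa using hB
    | succ i ih => rw [pow_succ, ← mul_assoc]; exact ih.mul_M1
  have right₂ (i : ℕ) {B : GL (Fin 2) (ZMod n)} (hB : Frak n B) : Frak n (B * M2 n ^ i).val := by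
    induction i with
    | zero => simpa using hB
    | succ i ih => rw [pow_succ, ← mul_assoc]; exact ih.mul_M2
  obtain ⟨i, j, rfl⟩ := exists_dihedral_three_eq x
  obtain ⟨k, l, rfl⟩ := exists_dihedral_three_eq y
  simp only [map_mul, map_pow, dihedralRep_r, dihedralRep_sr]
  rw [mul_assoc (M2 n ^ _), ← mul_assoc _ (M2 n ^ _)]
  exact right₁ _ (right₂ _ (left₂ _ (left₁ _ h)))

end Dihedral

section FixedPoints

/-- The elements of `GL₂(ℤ/nℤ)` lying in `𝔉ₙ`. -/
def frakSet (n : ℕ) : Set (GL (Fin 2) (ZMod n)) := {A | Frak n A}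

theorem sum_dihedral_three_of_class_function (f : DihedralGroup 3 → ℕ)
    (hf : ∀ u h, f (u * h * u⁻¹) = f h) :
    ∑ h, f h = f 1 + 2 * f (.r 1) + 3 * f (.sr 0) := by
  have hu : (Finset.univ : Finset (DihedralGroup 3)) = {1, .r 1, .r 2, .sr 0, .sr 1, .sr 2} := by
    decide
  have h₁ := hf (.sr 0) (.r 1)
  have h₂ := hf (.r 1) (.sr 0)
  have h₃ := hf (.r 2) (.sr 0)
  rw [show (.sr 0 * .r 1 * (.sr 0)⁻¹ : DihedralGroup 3) = .r 2 by decide] at h₁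
  rw [show (.r 1 * .sr 0 * (.r 1)⁻¹ : DihedralGroup 3) = .sr 1 by decide] at h₂
  rw [show (.r 2 * .sr 0 * (.r 2)⁻¹ : DihedralGroup 3) = .sr 2 by decide] at h₃
  rw [hu, Finset.sum_insert (by decide), Finset.sum_insert (by decide),
    Finset.sum_insert (by decide), Finset.sum_insert (by decide), Finset.sum_insert (by decide),
    Finset.sum_singleton, h₁, h₂, h₃]
  ring

/-- The number of elements of `𝔉ₙ` fixed by a pair in the copies of `S₃`. -/
noncomputable def pairFixed (n : ℕ) (h k : DihedralGroup 3) : ℕ :=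
  Nat.card {A : frakSet n // dihedralRep n h * (A : GL (Fin 2) (ZMod n)) = A * dihedralRep n k}

/-- The number of square roots in `𝔉ₙ` of an element of the copy of `S₃`. -/
noncomputable def squareRoots (n : ℕ) (h : DihedralGroup 3) : ℕ :=
  Nat.card {A : frakSet n // (A : GL (Fin 2) (ZMod n)) * A = dihedralRep n h}

/-- Two-sided translation of `𝔉ₙ`. -/
noncomputable def frakTranslate (n : ℕ) (u w : DihedralGroup 3) : frakSet n ≃ frakSet n where
  toFun A := ⟨dihedralRep n u * A * dihedralRep n w, Frak.mul_mul A.2 u w⟩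
  invFun A := ⟨dihedralRep n u⁻¹ * A * dihedralRep n w⁻¹, Frak.mul_mul A.2 u⁻¹ w⁻¹⟩
  left_inv A := by simp [mul_assoc]
  right_inv A := by simp [mul_assoc]

theorem pairFixed_conj (n : ℕ) (u w h k : DihedralGroup 3) :
    pairFixed n (u * h * u⁻¹) (w * k * w⁻¹) = pairFixed n h k := by
  refine (Nat.card_congr ((frakTranslate n u w⁻¹).subtypeEquiv fun A => ?_)).symm
  simp only [frakTranslate, Equiv.coe_fn_mk, map_mul, map_inv, mul_assoc, inv_mul_cancel_left,
    mul_right_inj]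
  rw [← mul_assoc, ← mul_assoc, mul_left_inj]

theorem squareRoots_conj (n : ℕ) (u h : DihedralGroup 3) :
    squareRoots n (u * h * u⁻¹) = squareRoots n h := by
  refine (Nat.card_congr ((frakTranslate n u u⁻¹).subtypeEquiv fun A => ?_)).symm
  simp only [frakTranslate, Equiv.coe_fn_mk, map_mul, map_inv, mul_assoc, inv_mul_cancel_left,
    mul_right_inj]
  rw [← mul_assoc, mul_left_inj]

theorem Theta_eq_card_quot (n : ℕ) :
    Theta n = Nat.card (Quot fun A B : frakSet n => ∃ h k,
      (B : GL (Fin 2) (ZMod n)) = dihedralRep n h * A * dihedralRep n k ∨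
      (B : GL (Fin 2) (ZMod n)) = dihedralRep n h * (A : GL (Fin 2) (ZMod n))⁻¹ *
        dihedralRep n k) := by
  let e : frakSet n ≃ {A : Matrix (Fin 2) (Fin 2) (ZMod n) // Frak n A} :=
    Equiv.ofBijective (fun A => ⟨A.1.val, A.2⟩) ⟨fun A B h => by
      exact Subtype.ext (Units.ext (congrArg Subtype.val h)), fun A =>
      ⟨⟨Matrix.nonsingInvUnit A.1 (by rw [Matrix.det_fin_two]; exact A.2.1), A.2⟩, rfl⟩⟩
  refine (Nat.card_congr (Quot.congr e fun A B => ?_)).symm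
  change _ ↔ BRel n A.1.val B.1.val
  simp only [BRel, ← range_dihedralRep, MonoidHom.mem_range]
  simp only [← Matrix.coe_units_inv, ← Units.val_mul, Units.val_inj]
  constructor
  · rintro ⟨h, k, H⟩
    exact ⟨_, _, ⟨k, rfl⟩, ⟨h, rfl⟩, H⟩
  · rintro ⟨_, _, ⟨k, rfl⟩, ⟨h, rfl⟩, H⟩
    exact ⟨h, k, H⟩

theorem Theta_eq_sum (n : ℕ) [NeZero n] :
    72 * Theta n = ∑ h, ∑ k, pairFixed n h k + 6 * ∑ h, squareRoots n h := by
  have h := card_quot_two_sided_mul_inv (dihedralRep n) (frakSet n)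
    (fun h k A hA => Frak.mul_mul hA h k) (fun A hA => Frak.inv hA)
  rw [← Theta_eq_card_quot, show Fintype.card (DihedralGroup 3) = 6 from rfl] at h
  exact h

theorem dihedralRep_mul_eq_entries {n : ℕ} {A : GL (Fin 2) (ZMod n)} :
    (M2 n * A = A * M2 n ↔ A.val 1 0 = A.val 0 1 ∧ A.val 1 1 = A.val 0 0) ∧
    (M1 n * A = A * M1 n ↔ A.val 1 0 = -A.val 0 1 ∧ A.val 1 1 = A.val 0 0 + A.val 0 1) := by
  simp only [← Units.val_inj, Units.val_mul, coe_M1, coe_M2, ← Matrix.ext_iff, Fin.forall_fin_two,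
    Matrix.mul_apply, Fin.sum_univ_two, Matrix.of_apply, Matrix.cons_val]
  grind

theorem pairFixed_sr_sr (n : ℕ) [Nontrivial (ZMod n)] : pairFixed n (.sr 0) (.sr 0) = 0 := by
  rw [pairFixed, Nat.card_eq_zero]
  refine Or.inl ⟨fun ⟨⟨A, hA⟩, h⟩ => ?_⟩
  rw [dihedralRep_sr, dihedralRep_mul_eq_entries.1] at h
  exact not_isUnit_zero ((hA.2.2.2.2.2.2.2.2.2).of_eq_or_neg (y := 0) (by grind))

theorem pairFixed_r_sr (n : ℕ) [Nontrivial (ZMod n)] (h3 : IsUnit (3 : ZMod n)) :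
    pairFixed n (.r 1) (.sr 0) = 0 := by
  rw [pairFixed, Nat.card_eq_zero]
  refine Or.inl ⟨fun ⟨⟨A, hA⟩, h⟩ => ?_⟩
  rw [dihedralRep_sr, dihedralRep_r] at h
  simp only [← Units.val_inj, Units.val_mul, coe_M1, coe_M2, ← Matrix.ext_iff, Fin.forall_fin_two,
    Matrix.mul_apply, Fin.sum_univ_two, Matrix.of_apply, Matrix.cons_val] at h
  exact not_isUnit_zero ((h3.mul hA.2.2.1).of_eq_or_neg (y := 0) (by grind))

theorem pairFixed_sr_r (n : ℕ) [Nontrivial (ZMod n)] (h3 : IsUnit (3 : ZMod n)) :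
    pairFixed n (.sr 0) (.r 1) = 0 := by
  rw [pairFixed, Nat.card_eq_zero]
  refine Or.inl ⟨fun ⟨⟨A, hA⟩, h⟩ => ?_⟩
  rw [dihedralRep_sr, dihedralRep_r] at h
  simp only [← Units.val_inj, Units.val_mul, coe_M1, coe_M2, ← Matrix.ext_iff, Fin.forall_fin_two,
    Matrix.mul_apply, Fin.sum_univ_two, Matrix.of_apply, Matrix.cons_val] at h
  exact not_isUnit_zero ((h3.mul hA.2.2.1).of_eq_or_neg (y := 0) (by grind))

theorem M1_ne_one (n : ℕ) [Nontrivial (ZMod n)] : M1 n ≠ 1 := fun h => by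
  have := congrArg (fun g : GL (Fin 2) (ZMod n) => g.val 0 1) h
  simp [coe_M1] at this

theorem M2_ne_one (n : ℕ) [Nontrivial (ZMod n)] : M2 n ≠ 1 := fun h => by
  have := congrArg (fun g : GL (Fin 2) (ZMod n) => g.val 0 1) h
  simp [coe_M2] at this

theorem sum_pairFixed (n : ℕ) [Nontrivial (ZMod n)] (h3 : IsUnit (3 : ZMod n)) :
    ∑ h, ∑ k, pairFixed n h k = Nat.card (frakSet n) + 4 * pairFixed n (.r 1) (.r 1) := by
  have hinner (h : DihedralGroup 3) : ∑ k, pairFixed n h k =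
      pairFixed n h 1 + 2 * pairFixed n h (.r 1) + 3 * pairFixed n h (.sr 0) :=
    sum_dihedral_three_of_class_function _ fun u k => by
      simpa using pairFixed_conj n 1 u h k
  have houter := sum_dihedral_three_of_class_function (fun h => ∑ k, pairFixed n h k) fun u h =>
    Finset.sum_congr rfl fun k _ => by simpa using pairFixed_conj n u 1 h k
  have h₁ : pairFixed n 1 1 = Nat.card (frakSet n) :=
    Nat.card_congr (Equiv.subtypeUnivEquiv fun A => by simp)
  have hr := M1_ne_one n
  have hs := M2_ne_one n
  have h₂ : pairFixed n 1 (.r 1) = 0 := by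
    simp [pairFixed, dihedralRep_r, hr]
  have h₃ : pairFixed n 1 (.sr 0) = 0 := by
    simp [pairFixed, dihedralRep_sr, hs]
  have h₄ : pairFixed n (.r 1) 1 = 0 := by
    simp [pairFixed, dihedralRep_r, hr]
  have h₅ : pairFixed n (.sr 0) 1 = 0 := by
    simp [pairFixed, dihedralRep_sr, hs]
  rw [houter, hinner, hinner, hinner, h₁, h₂, h₃, h₄, h₅, pairFixed_sr_sr, pairFixed_r_sr n h3,
    pairFixed_sr_r n h3]
  ring

theorem squareRoots_sr (n : ℕ) [NeZero n] [Nontrivial (ZMod n)] : squareRoots n (.sr 0) = 0 := by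
  rw [squareRoots, Nat.card_eq_zero]
  refine Or.inl ⟨fun ⟨⟨A, hA⟩, h⟩ => ?_⟩
  have hc := pairFixed_sr_sr n
  rw [pairFixed, Nat.card_eq_zero, or_iff_left (Finite.not_infinite inferInstance)] at hc
  exact hc.false ⟨⟨A, hA⟩, by rw [← h, mul_assoc]⟩

theorem squareRoots_r (n : ℕ) [Nontrivial (ZMod n)] (h2 : IsUnit (2 : ZMod n))
    (hnorm : ∀ x y : ZMod n, IsUnit y → IsUnit (x ^ 2 + x * y + y ^ 2)) :
    squareRoots n (.r 1) = 0 := by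
  rw [squareRoots, Nat.card_eq_zero]
  refine Or.inl ⟨fun ⟨⟨A, hA⟩, h⟩ => ?_⟩
  rw [dihedralRep_r] at h
  change A * A = M1 n at h
  have hc : M1 n * A = A * M1 n := by rw [← h, mul_assoc]
  rw [dihedralRep_mul_eq_entries.2] at hc
  simp only [← Units.val_inj, Units.val_mul, coe_M1, ← Matrix.ext_iff, Fin.forall_fin_two,
    Matrix.mul_apply, Fin.sum_univ_two, Matrix.of_apply, Matrix.cons_val] at h
  obtain ⟨⟨h₁, h₂⟩, h₃, h₄⟩ := h
  have ha : A.val 0 0 + 2 * A.val 0 1 = 0 := by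
    rw [← hA.2.1.mul_right_eq_zero, ← h₄, hc.1, hc.2]
    ring
  exact not_isUnit_zero ((hnorm (3 * A.val 0 1 - 1) 2 h2).of_eq_or_neg (y := 0) (by grind))

theorem sum_squareRoots (n : ℕ) [NeZero n] [Nontrivial (ZMod n)] (h2 : IsUnit (2 : ZMod n))
    (hnorm : ∀ x y : ZMod n, IsUnit y → IsUnit (x ^ 2 + x * y + y ^ 2)) :
    ∑ h, squareRoots n h = squareRoots n 1 := by
  rw [sum_dihedral_three_of_class_function _ (squareRoots_conj n), squareRoots_r n h2 hnorm,
    squareRoots_sr]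
  simp

/-- The conditions of `𝔉ₙ` in terms of the four entries. -/
theorem card_frakSet (n : ℕ) : Nat.card (frakSet n) =
    Nat.card {v : ZMod n × ZMod n × ZMod n × ZMod n // Frak n !![v.1, v.2.1; v.2.2.1, v.2.2.2]} := by
  refine Nat.card_eq_of_bijective (fun A => ⟨(A.1.val 0 0, A.1.val 0 1, A.1.val 1 0, A.1.val 1 1),
    A.2⟩) ⟨fun A B h => ?_, fun ⟨v, hv⟩ => ⟨⟨Matrix.nonsingInvUnit _
      (by rw [Matrix.det_fin_two]; exact hv.1), hv⟩, ?_⟩⟩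
  · replace h := congrArg Subtype.val h
    simp only [Prod.mk.injEq] at h
    refine Subtype.ext (Units.ext ?_)
    simpa [← Matrix.ext_iff, and_assoc] using h
  · simp [Matrix.nonsingInvUnit]

theorem pairFixed_r_r (n : ℕ)
    (hnorm : ∀ x y : ZMod n, IsUnit y → IsUnit (x ^ 2 + x * y + y ^ 2)) :
    pairFixed n (.r 1) (.r 1) =
      Nat.card {v : ZMod n × ZMod n // IsUnit v.1 ∧ IsUnit v.2 ∧ IsUnit (v.1 + v.2)} := by
  have hfrak (a b : ZMod n) (ha : IsUnit a) (hb : IsUnit b) (hab : IsUnit (a + b)) :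
      Frak n !![a, b; -b, a + b] := by
    simp only [Frak, Matrix.of_apply, Matrix.cons_val]
    exact ⟨(hnorm a b hb).of_eq_or_neg (by grind), ha, hb, hb.neg, hab, hab,
      ha.of_eq_or_neg (by grind), hab.of_eq_or_neg (by grind), ha.of_eq_or_neg (by grind),
      hb.of_eq_or_neg (by grind)⟩
  rw [pairFixed, dihedralRep_r]
  refine Nat.card_eq_of_bijective (fun A => ⟨(A.1.1.val 0 0, A.1.1.val 0 1),
    ⟨A.1.2.2.1, A.1.2.2.2.1, A.1.2.2.2.2.2.2.1⟩⟩) ⟨fun ⟨⟨A, hA⟩, h⟩ ⟨⟨B, hB⟩, h'⟩ e => ?_,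
    fun ⟨v, h₁, h₂, h₃⟩ => ⟨⟨⟨Matrix.nonsingInvUnit _ (by
      rw [Matrix.det_fin_two]; exact (hfrak v.1 v.2 h₁ h₂ h₃).1), hfrak v.1 v.2 h₁ h₂ h₃⟩, ?_⟩, ?_⟩⟩
  · rw [dihedralRep_mul_eq_entries.2] at h h'
    simp only [Subtype.mk.injEq, Prod.mk.injEq] at e
    refine Subtype.ext (Subtype.ext (Units.ext ?_))
    simp only [← Matrix.ext_iff, Fin.forall_fin_two]
    grind
  · rw [dihedralRep_mul_eq_entries.2]
    simp [Matrix.nonsingInvUnit]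
  · simp [Matrix.nonsingInvUnit]

theorem squareRoots_one (n : ℕ) : squareRoots n 1 =
    Nat.card {v : ZMod n × ZMod n // IsUnit v.1 ∧ IsUnit v.2 ∧ IsUnit (v.1 + v.2) ∧
      IsUnit (1 - v.1 ^ 2) ∧ IsUnit (1 - (v.1 + v.2) ^ 2) ∧
      IsUnit (1 - v.1 * (v.1 + v.2))} := by
  have hfrak (a b : ZMod n) (ha : IsUnit a) (hb : IsUnit b) (hab : IsUnit (a + b))
      (h₁ : IsUnit (1 - a ^ 2)) (h₂ : IsUnit (1 - (a + b) ^ 2)) (h₃ : IsUnit (1 - a * (a + b))) :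
      Frak n !![a, b; (1 - a ^ 2) * Ring.inverse b, -a] := by
    have hi := hb.ringInverse
    have hbi := Ring.mul_inverse_cancel b hb
    simp only [Frak, Matrix.of_apply, Matrix.cons_val]
    exact ⟨isUnit_one.of_eq_or_neg (by grind), ha, hb, h₁.mul hi, ha.neg, hab,
      (h₃.mul hi).of_eq_or_neg (by grind), (h₃.mul hi).of_eq_or_neg (by grind),
      hab.of_eq_or_neg (by grind), (h₂.mul hi).of_eq_or_neg (by grind)⟩
  have hsq {A : GL (Fin 2) (ZMod n)} (hA : Frak n A) : A * A = 1 ↔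
      A.val 1 1 = -A.val 0 0 ∧ A.val 1 0 = (1 - A.val 0 0 ^ 2) * Ring.inverse (A.val 0 1) := by
    have hb := hA.2.2.1
    have hbi := Ring.mul_inverse_cancel _ hb
    simp only [← Units.val_inj, Units.val_mul, Units.val_one, ← Matrix.ext_iff,
      Fin.forall_fin_two, Matrix.mul_apply, Fin.sum_univ_two, Matrix.one_apply]
    constructor
    · rintro ⟨⟨h₁, h₂⟩, h₃, h₄⟩
      simp at h₁ h₂
      grind
    · rintro ⟨h₁, h₂⟩
      simp
      grind
  have hfwd {A : GL (Fin 2) (ZMod n)} (hA : Frak n A) (h : A * A = 1) :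
      IsUnit (A.val 0 0) ∧ IsUnit (A.val 0 1) ∧ IsUnit (A.val 0 0 + A.val 0 1) ∧
      IsUnit (1 - A.val 0 0 ^ 2) ∧ IsUnit (1 - (A.val 0 0 + A.val 0 1) ^ 2) ∧
      IsUnit (1 - A.val 0 0 * (A.val 0 0 + A.val 0 1)) := by
    rw [hsq hA] at h
    have hbi := Ring.mul_inverse_cancel _ hA.2.2.1
    obtain ⟨h1, h2, h3, h4, h5, h6, h7, h8, h9, h10⟩ := hA
    exact ⟨h2, h3, h6, (h3.mul h4).of_eq_or_neg (by grind), (h3.mul h10).of_eq_or_neg (by grind),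
      (h3.mul h7).of_eq_or_neg (by grind)⟩
  rw [squareRoots, map_one]
  refine Nat.card_eq_of_bijective (fun A => ⟨(A.1.1.val 0 0, A.1.1.val 0 1),
    hfwd A.1.2 A.2⟩)
    ⟨fun ⟨⟨A, hA⟩, h⟩ ⟨⟨B, hB⟩, h'⟩ e => ?_,
    fun ⟨v, h₁, h₂, h₃, h₄, h₅, h₆⟩ => ⟨⟨⟨Matrix.nonsingInvUnit _ (by
      rw [Matrix.det_fin_two]; exact (hfrak v.1 v.2 h₁ h₂ h₃ h₄ h₅ h₆).1),
      hfrak v.1 v.2 h₁ h₂ h₃ h₄ h₅ h₆⟩, ?_⟩, ?_⟩⟩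
  · rw [hsq hA] at h
    rw [hsq hB] at h'
    simp only [Subtype.mk.injEq, Prod.mk.injEq] at e
    refine Subtype.ext (Subtype.ext (Units.ext ?_))
    simp only [← Matrix.ext_iff, Fin.forall_fin_two]
    grind
  · rw [hsq (hfrak v.1 v.2 h₁ h₂ h₃ h₄ h₅ h₆)]
    simp [Matrix.nonsingInvUnit]
  · simp [Matrix.nonsingInvUnit]

end FixedPoints

section Counting

theorem AddMonoidHom.card_subtype_comp_mul_card {G H : Type*} [AddCommGroup G] [AddCommGroup H]
    (g : G →+ H) (hg : Function.Surjective g) (P : H → Prop) :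
    Nat.card {x // P (g x)} * Nat.card H = Nat.card G * Nat.card {y // P y} := by
  obtain ⟨s, hs⟩ := hg.hasRightInverse
  have key (P : H → Prop) : Nat.card {x // P (g x)} = Nat.card {y // P y} * Nat.card g.ker := by
    rw [← Nat.card_prod]
    exact Nat.card_congr
      { toFun := fun x => (⟨g x, x.2⟩, ⟨x - s (g x), by simp [AddMonoidHom.mem_ker, hs (g x)]⟩)
        invFun := fun y => ⟨s y.1 + y.2, by
          have := AddMonoidHom.mem_ker.1 y.2.2
          simpa [this, hs y.1.1] using y.1.2⟩
        left_inv := fun x => by simp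
        right_inv := fun y => by
          have := AddMonoidHom.mem_ker.1 y.2.2
          simp [this, hs y.1.1] }
  have hG : Nat.card G = Nat.card H * Nat.card g.ker := by
    simpa using key fun _ => True
  rw [key, hG]
  ring

theorem Nat.card_subtype_and_of_fiber {α β : Type*} [Finite α] [Finite β] {P : α → Prop}
    {Q : α → β → Prop} {k : ℕ} (h : ∀ a, P a → Nat.card {b // Q a b} = k) :
    Nat.card {v : α × β // P v.1 ∧ Q v.1 v.2} = Nat.card {a // P a} * k := by
  classical
  let _ : Fintype {a // P a} := Fintype.ofFinite _
  have e : {v : α × β // P v.1 ∧ Q v.1 v.2} ≃ Σ a : {a // P a}, {b // Q a b} :=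
    { toFun := fun v => ⟨⟨v.1.1, v.2.1⟩, ⟨v.1.2, v.2.2⟩⟩
      invFun := fun w => ⟨(w.1, w.2), w.1.2, w.2.2⟩
      left_inv := fun _ => rfl
      right_inv := fun _ => rfl }
  rw [Nat.card_congr e, Nat.card_sigma, Finset.sum_congr rfl fun (a : {a // P a}) _ => h a a.2]
  simp

variable {p : ℕ} [Fact p.Prime]

theorem ZMod.card_notMem_finset (s : Finset (ZMod p)) :
    Nat.card {b // b ∉ s} = p - s.card := by
  rw [Nat.card_eq_fintype_card, Fintype.card_subtype_compl, ZMod.card, Fintype.card_coe]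

theorem card_units_pair_mod_prime :
    Nat.card {v : ZMod p × ZMod p // v.1 ≠ 0 ∧ v.2 ≠ 0 ∧ v.1 + v.2 ≠ 0} = (p - 1) * (p - 2) := by
  rw [Nat.card_subtype_and_of_fiber (k := p - 2) (P := fun a : ZMod p => a ≠ 0)
    (Q := fun a b => b ≠ 0 ∧ a + b ≠ 0)]
  · congr 1
    simpa only [Finset.mem_singleton, Finset.card_singleton] using ZMod.card_notMem_finset ({0} : Finset (ZMod p))
  · intro a ha
    have h := ZMod.card_notMem_finset {0, -a}
    rw [Finset.card_pair (by simpa using ha)] at h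
    rw [← h]
    refine Nat.card_congr (Equiv.subtypeEquivRight fun b => ?_)
    simp only [Finset.mem_insert, Finset.mem_singleton]
    grind

theorem card_involutions_mod_prime (hp : 3 < p) :
    Nat.card {v : ZMod p × ZMod p // v.1 ≠ 0 ∧ v.2 ≠ 0 ∧ v.1 + v.2 ≠ 0 ∧
      1 - v.1 ^ 2 ≠ 0 ∧ 1 - (v.1 + v.2) ^ 2 ≠ 0 ∧ 1 - v.1 * (v.1 + v.2) ≠ 0} =
      (p - 3) * (p - 5) := by
  have h2 : (2 : ZMod p) ≠ 0 := by
    have := (ZMod.natCast_eq_zero_iff 2 p).not.2 (Nat.not_dvd_of_pos_of_lt (by simp) (by omega))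
    simpa using this
  have hsq (x : ZMod p) : 1 - x ^ 2 = 0 ↔ x = 1 ∨ x = -1 := by
    rw [sub_eq_zero, eq_comm, sq_eq_one_iff]
  have hcongr : Nat.card {v : ZMod p × ZMod p // v.1 ≠ 0 ∧ v.2 ≠ 0 ∧ v.1 + v.2 ≠ 0 ∧
      1 - v.1 ^ 2 ≠ 0 ∧ 1 - (v.1 + v.2) ^ 2 ≠ 0 ∧ 1 - v.1 * (v.1 + v.2) ≠ 0} =
      Nat.card {v : ZMod p × ZMod p // v.1 ∉ ({0, 1, -1} : Finset (ZMod p)) ∧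
        v.2 ∉ ({0, -v.1, 1 - v.1, -1 - v.1, v.1⁻¹ - v.1} : Finset (ZMod p))} := by
    refine Nat.card_congr (Equiv.subtypeEquivRight fun v => ?_)
    simp only [ne_eq, hsq, Finset.mem_insert, Finset.mem_singleton]
    by_cases hv : v.1 = 0
    · simp [hv]
    · have := mul_inv_cancel₀ hv
      grind
  rw [hcongr, Nat.card_subtype_and_of_fiber (k := p - 5)
    (P := fun a : ZMod p => a ∉ ({0, 1, -1} : Finset (ZMod p)))
    (Q := fun a b => b ∉ ({0, -a, 1 - a, -1 - a, a⁻¹ - a} : Finset (ZMod p))),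
    ZMod.card_notMem_finset]
  · rw [Finset.card_eq_three.2 ⟨0, 1, -1, by simp, by simp, by grind, rfl⟩]
  · intro a ha
    simp only [Finset.mem_insert, Finset.mem_singleton, not_or] at ha
    have hi := mul_inv_cancel₀ ha.1
    have hsqa : a * a ≠ 1 := by grind
    rw [ZMod.card_notMem_finset]
    congr 1
    repeat rw [Finset.card_insert_of_notMem]
    · simp
    all_goals
      simp only [Finset.mem_insert, Finset.mem_singleton]
      grind

theorem card_injective_quadruples_mod_prime :
    Nat.card {v : ZMod p × ZMod p × ZMod p × ZMod p // v.1 ≠ 0 ∧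
      v.2.1 ∉ ({0, v.1} : Finset (ZMod p)) ∧ v.2.2.1 ∉ ({0, v.1, v.2.1} : Finset (ZMod p)) ∧
      v.2.2.2 ∉ ({0, v.1, v.2.1, v.2.2.1} : Finset (ZMod p))} =
      (p - 1) * ((p - 2) * ((p - 3) * (p - 4))) := by
  rw [Nat.card_subtype_and_of_fiber (k := (p - 2) * ((p - 3) * (p - 4)))
    (P := fun a : ZMod p => a ≠ 0)
    (Q := fun a (v : ZMod p × ZMod p × ZMod p) => v.1 ∉ ({0, a} : Finset (ZMod p)) ∧
      v.2.1 ∉ ({0, a, v.1} : Finset (ZMod p)) ∧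
      v.2.2 ∉ ({0, a, v.1, v.2.1} : Finset (ZMod p)))]
  · congr 1
    simpa only [Finset.mem_singleton, Finset.card_singleton] using ZMod.card_notMem_finset ({0} : Finset (ZMod p))
  intro a ha
  rw [Nat.card_subtype_and_of_fiber (k := (p - 3) * (p - 4))
    (P := fun b : ZMod p => b ∉ ({0, a} : Finset (ZMod p)))
    (Q := fun b (v : ZMod p × ZMod p) => v.1 ∉ ({0, a, b} : Finset (ZMod p)) ∧
      v.2 ∉ ({0, a, b, v.1} : Finset (ZMod p))), ZMod.card_notMem_finset,
    Finset.card_pair ha.symm]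
  intro b hb
  simp only [Finset.mem_insert, Finset.mem_singleton, not_or] at hb
  rw [Nat.card_subtype_and_of_fiber (k := p - 4)
    (P := fun c : ZMod p => c ∉ ({0, a, b} : Finset (ZMod p)))
    (Q := fun c d => d ∉ ({0, a, b, c} : Finset (ZMod p))), ZMod.card_notMem_finset]
  · congr 2
    exact Finset.card_eq_three.2 ⟨0, a, b, by grind, by grind, by grind, rfl⟩
  intro c hc
  simp only [Finset.mem_insert, Finset.mem_singleton, not_or] at hc
  rw [ZMod.card_notMem_finset]
  congr 1
  repeat rw [Finset.card_insert_of_notMem]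
  · simp
  all_goals
    simp only [Finset.mem_insert, Finset.mem_singleton]
    grind

theorem frakToQuadruple_spec {F : Type*} [Field F] {a b c d : F} (h1 : a * d - b * c ≠ 0)
    (h3 : b ≠ 0) (h4 : c ≠ 0) (h5 : d ≠ 0) (h6 : a + b ≠ 0) (h7 : c + d ≠ 0)
    (h9 : b - d ≠ 0) (h10 : a + b - c - d ≠ 0) :
    (b * c / d ≠ 0 ∧ b * c / d ≠ c ∧ b * c / d ≠ a) ∧ c * (a + b) / (c + d) ≠ 0 ∧
      c * (a + b) / (c + d) ≠ c ∧ c * (a + b) / (c + d) ≠ a ∧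
      c * (a + b) / (c + d) ≠ b * c / d := by
  simp only [ne_eq, div_eq_div_iff h7 h5, div_eq_iff h5, div_eq_iff h7, zero_mul]
  refine ⟨⟨?_, ?_, ?_⟩, ?_, ?_, ?_, ?_⟩ <;> intro h <;> grind

theorem frakToQuadruple_left_inv {F : Type*} [Field F] {a b c d : F} (h1 : a * d - b * c ≠ 0)
    (h4 : c ≠ 0) (h5 : d ≠ 0) (h7 : c + d ≠ 0) :
    b * c / d * (a - c * (a + b) / (c + d)) / (c * (a + b) / (c + d) - b * c / d) = b ∧
      c * (a - c * (a + b) / (c + d)) / (c * (a + b) / (c + d) - b * c / d) = d := by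
  have e : c * (a + b) / (c + d) - b * c / d = c * (a * d - b * c) / ((c + d) * d) := by
    field_simp
    ring
  have e' : a - c * (a + b) / (c + d) = (a * d - b * c) / (c + d) := by
    field_simp
    ring
  rw [e, e']
  generalize a * d - b * c = D at h1
  generalize c + d = s at h7
  constructor <;> field_simp

theorem quadrupleToFrak_spec {F : Type*} [Field F] {x y z w : F} (h1 : x ≠ 0) (h3 : y ≠ x)
    (h4 : z ≠ 0) (h5 : z ≠ x) (h6 : z ≠ y) (h7 : w ≠ 0) (h8 : w ≠ x) (h9 : w ≠ y) (h10 : w ≠ z) :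
    y * (x * (y - w) / (w - z)) - z * (y - w) / (w - z) * x ≠ 0 ∧ z * (y - w) / (w - z) ≠ 0 ∧
      x * (y - w) / (w - z) ≠ 0 ∧
      y + z * (y - w) / (w - z) ≠ 0 ∧
      x + x * (y - w) / (w - z) ≠ 0 ∧ y - x ≠ 0 ∧
      z * (y - w) / (w - z) - x * (y - w) / (w - z) ≠ 0 ∧
      y + z * (y - w) / (w - z) - x - x * (y - w) / (w - z) ≠ 0 := by
  have hwz : w - z ≠ 0 := sub_ne_zero.2 h10
  have hyw : y - w ≠ 0 := sub_ne_zero.2 h9.symm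
  have hyz : y - z ≠ 0 := sub_ne_zero.2 h6.symm
  have e₁ : y + z * (y - w) / (w - z) = w * (y - z) / (w - z) := by
    field_simp
    ring
  have e₂ : x + x * (y - w) / (w - z) = x * (y - z) / (w - z) := by
    field_simp
    ring
  have e₃ : y * (x * (y - w) / (w - z)) - z * (y - w) / (w - z) * x =
      x * (y - z) * (y - w) / (w - z) := by
    ring
  have e₄ : z * (y - w) / (w - z) - x * (y - w) / (w - z) = (z - x) * (y - w) / (w - z) := by
    ring
  have e₅ : w * (y - z) / (w - z) - x * (y - z) / (w - z) = (w - x) * (y - z) / (w - z) := by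
    ring
  rw [sub_sub _ x, e₁, e₂, e₃, e₄, e₅]
  simp [sub_eq_zero, *]

theorem quadrupleToFrak_right_inv {F : Type*} [Field F] {x y z w : F} (h1 : x ≠ 0)
    (h6 : z ≠ y) (h9 : w ≠ y) (h10 : w ≠ z) :
    z * (y - w) / (w - z) * x / (x * (y - w) / (w - z)) = z ∧
      x * (y + z * (y - w) / (w - z)) / (x + x * (y - w) / (w - z)) = w := by
  have hwz : w - z ≠ 0 := sub_ne_zero.2 h10
  have hyw : y - w ≠ 0 := sub_ne_zero.2 h9.symm
  have hyz : y - z ≠ 0 := sub_ne_zero.2 h6.symm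
  have e₁ : y + z * (y - w) / (w - z) = w * (y - z) / (w - z) := by
    field_simp
    ring
  have e₂ : x + x * (y - w) / (w - z) = x * (y - z) / (w - z) := by
    field_simp
    ring
  rw [e₁, e₂]
  generalize y - z = s at hyz
  generalize y - w = t at hyw
  generalize w - z = u at hwz
  constructor <;> field_simp

theorem card_frak_mod_prime :
    Nat.card {v : ZMod p × ZMod p × ZMod p × ZMod p // Frak p !![v.1, v.2.1; v.2.2.1, v.2.2.2]} =
      (p - 1) * ((p - 2) * ((p - 3) * (p - 4))) := by
  rw [← card_injective_quadruples_mod_prime]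
  simp only [Frak, Matrix.of_apply, Matrix.cons_val, isUnit_iff_ne_zero, Finset.mem_insert,
    Finset.mem_singleton, not_or]
  exact Nat.card_congr
    { toFun := fun ⟨(a, b, c, d), h⟩ => ⟨(c, a, b * c / d, c * (a + b) / (c + d)), by
        obtain ⟨h1, h2, h3, h4, h5, h6, h7, h8, h9, h10⟩ := h
        exact ⟨h4, ⟨h2, sub_ne_zero.1 h8⟩, frakToQuadruple_spec h1 h3 h4 h5 h6 h7 h9 h10⟩⟩
      invFun := fun ⟨(x, y, z, w), h⟩ =>
        ⟨(y, z * (y - w) / (w - z), x, x * (y - w) / (w - z)), by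
        obtain ⟨h1, ⟨h2, h3⟩, ⟨h4, h5, h6⟩, h7, h8, h9, h10⟩ := h
        obtain ⟨k1, k2, k3, k4⟩ := quadrupleToFrak_spec h1 h3 h4 h5 h6 h7 h8 h9 h10
        exact ⟨k1, h2, k2, h1, k3, k4⟩⟩
      left_inv := fun ⟨(a, b, c, d), h⟩ => by
        obtain ⟨h1, h2, h3, h4, h5, h6, h7, h8, h9, h10⟩ := h
        obtain ⟨e, e'⟩ := frakToQuadruple_left_inv h1 h4 h5 h7
        exact Subtype.ext (Prod.ext rfl (Prod.ext e (Prod.ext rfl e')))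
      right_inv := fun ⟨(x, y, z, w), h⟩ => by
        obtain ⟨h1, ⟨h2, h3⟩, ⟨h4, h5, h6⟩, h7, h8, h9, h10⟩ := h
        obtain ⟨e, e'⟩ := quadrupleToFrak_right_inv h1 h6 h9 h10
        exact Subtype.ext (Prod.ext rfl (Prod.ext rfl (Prod.ext e e'))) }

end Counting

section PrimePower

theorem ZMod.isUnit_iff_castHom_ne_zero {p e : ℕ} (hp : p.Prime) (he : e ≠ 0)
    (x : ZMod (p ^ e)) :
    IsUnit x ↔ ZMod.castHom (dvd_pow_self p he) (ZMod p) x ≠ 0 := by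
  have : NeZero (p ^ e) := ⟨pow_ne_zero _ hp.ne_zero⟩
  obtain ⟨k, rfl⟩ := ZMod.natCast_zmod_surjective x
  rw [ZMod.isUnit_iff_coprime, map_natCast, ne_eq, ZMod.natCast_eq_zero_iff,
    Nat.coprime_pow_right_iff (Nat.pos_of_ne_zero he), Nat.coprime_comm, hp.coprime_iff_not_dvd]

theorem ZMod.sq_add_mul_add_sq_ne_zero {p : ℕ} (hp : p.Prime) (hmod : p % 3 = 2) {x y : ZMod p}
    (hy : y ≠ 0) : x ^ 2 + x * y + y ^ 2 ≠ 0 := by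
  have := Fact.mk hp
  intro h
  set t := x / y with ht
  have hx : x = t * y := by rw [ht, div_mul_cancel₀ _ hy]
  have ht2 : t ^ 2 + t + 1 = 0 := by
    have : y ^ 2 * (t ^ 2 + t + 1) = 0 := by rw [← h, hx]; ring
    exact (mul_eq_zero.1 this).resolve_left (pow_ne_zero _ hy)
  have ht3 : t ^ 3 = 1 := by linear_combination (t - 1) * ht2
  have ht0 : t ≠ 0 := by
    rintro h0
    simp [h0] at ht3
  have ht1 : t ≠ 1 := by
    intro h1
    rw [h1] at ht2
    have h3 : ((3 : ℕ) : ZMod p) = 0 := by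
      push_cast
      linear_combination ht2
    rw [ZMod.natCast_eq_zero_iff] at h3
    rcases (Nat.dvd_prime Nat.prime_three).1 h3 with h | h <;> omega
  have horder : orderOf t = 3 := orderOf_eq_prime ht3 ht1
  have hdvd : 3 ∣ p - 1 := horder ▸ orderOf_dvd_of_pow_eq_one (ZMod.pow_card_sub_one_eq_one ht0)
  omega

variable {p : ℕ} (m : ℕ)

theorem card_pairs_prime_pow (hp : p.Prime) (P : ZMod p × ZMod p → Prop)
    (g : ZMod (p ^ (m + 1)) →+* ZMod p) :
    Nat.card {v : ZMod (p ^ (m + 1)) × ZMod (p ^ (m + 1)) // P (g v.1, g v.2)} =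
      p ^ (2 * m) * Nat.card {v // P v} := by
  have h := AddMonoidHom.card_subtype_comp_mul_card (g.toAddMonoidHom.prodMap g.toAddMonoidHom)
    (Prod.map_surjective.2 ⟨ZMod.ringHom_surjective g, ZMod.ringHom_surjective g⟩) P
  simp only [Nat.card_prod, Nat.card_zmod] at h
  refine Nat.eq_of_mul_eq_mul_right (Nat.mul_pos hp.pos hp.pos) (h.trans ?_)
  ring

theorem card_quadruples_prime_pow (hp : p.Prime)
    (P : ZMod p × ZMod p × ZMod p × ZMod p → Prop) (g : ZMod (p ^ (m + 1)) →+* ZMod p) :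
    Nat.card {v : ZMod (p ^ (m + 1)) × ZMod (p ^ (m + 1)) × ZMod (p ^ (m + 1)) ×
      ZMod (p ^ (m + 1)) // P (g v.1, g v.2.1, g v.2.2.1, g v.2.2.2)} =
      p ^ (4 * m) * Nat.card {v // P v} := by
  have hg := ZMod.ringHom_surjective g
  have h := AddMonoidHom.card_subtype_comp_mul_card
    (g.toAddMonoidHom.prodMap
      (g.toAddMonoidHom.prodMap (g.toAddMonoidHom.prodMap g.toAddMonoidHom)))
    (Prod.map_surjective.2 ⟨hg, Prod.map_surjective.2 ⟨hg, Prod.map_surjective.2 ⟨hg, hg⟩⟩⟩) P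
  simp only [Nat.card_prod, Nat.card_zmod] at h
  refine Nat.eq_of_mul_eq_mul_right (pow_pos hp.pos 4) (Eq.trans ?_ (h.trans ?_))
  · rw [show p ^ 4 = p * (p * (p * p)) by ring]
    rfl
  · ring

theorem theta_prime_pow_succ (hp : p.Prime) (hp5 : 5 ≤ p) (hmod : p % 3 = 2) :
    72 * Theta (p ^ (m + 1)) =
      p ^ (4 * m) * ((p - 1) * ((p - 2) * ((p - 3) * (p - 4)))) +
        4 * (p ^ (2 * m) * ((p - 1) * (p - 2))) + 6 * (p ^ (2 * m) * ((p - 3) * (p - 5))) := by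
  have := Fact.mk hp
  have : NeZero (p ^ (m + 1)) := ⟨pow_ne_zero _ hp.ne_zero⟩
  have : Fact (1 < p ^ (m + 1)) := ⟨Nat.one_lt_pow m.succ_ne_zero hp.one_lt⟩
  have hu := ZMod.isUnit_iff_castHom_ne_zero hp m.succ_ne_zero
  generalize ZMod.castHom (dvd_pow_self p m.succ_ne_zero) (ZMod p) = g at hu
  have hsmall (k : ℕ) (h0 : 0 < k) (hk : k < p) : IsUnit (k : ZMod (p ^ (m + 1))) := by
    rw [hu, map_natCast, ne_eq, ZMod.natCast_eq_zero_iff]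
    exact Nat.not_dvd_of_pos_of_lt h0 hk
  have h2 : IsUnit (2 : ZMod (p ^ (m + 1))) := by simpa using hsmall 2 (by simp) (by omega)
  have h3 : IsUnit (3 : ZMod (p ^ (m + 1))) := by simpa using hsmall 3 (by simp) (by omega)
  have hnorm (x y : ZMod (p ^ (m + 1))) (hy : IsUnit y) : IsUnit (x ^ 2 + x * y + y ^ 2) := by
    rw [hu] at hy ⊢
    simpa using ZMod.sq_add_mul_add_sq_ne_zero hp hmod (x := g x) hy
  rw [Theta_eq_sum, sum_pairFixed _ h3, sum_squareRoots _ h2 hnorm, card_frakSet,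
    pairFixed_r_r _ hnorm, squareRoots_one, ← card_frak_mod_prime, ← card_units_pair_mod_prime,
    ← card_involutions_mod_prime (by omega), ← card_quadruples_prime_pow m hp _ g,
    ← card_pairs_prime_pow m hp _ g, ← card_pairs_prime_pow m hp _ g]
  simp only [Frak, hu, isUnit_iff_ne_zero, map_add, map_sub, map_mul, map_pow, map_one,
    Matrix.of_apply, Matrix.cons_val]

end PrimePower

/-- For a prime `p ≥ 5` with `p ≡ 2 (mod 3)` and `e ≥ 1`,
`72·Θ(p^e) = p^{4e} - 10p^{4e-1} + 35p^{4e-2} - 50p^{4e-3} + 24p^{4e-4}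
            + 10p^{2e} - 60p^{2e-1} + 98p^{2e-2}`. -/
theorem theta_prime_pow_two_mod_three (p : ℕ) (hp : p.Prime) (hp5 : 5 ≤ p)
    (hmod : p % 3 = 2) (e : ℕ) (he : 1 ≤ e) :
    (72 * Theta (p ^ e) : ℤ) =
      (p : ℤ) ^ (4 * e) - 10 * (p : ℤ) ^ (4 * e - 1) + 35 * (p : ℤ) ^ (4 * e - 2)
        - 50 * (p : ℤ) ^ (4 * e - 3) + 24 * (p : ℤ) ^ (4 * e - 4)
        + 10 * (p : ℤ) ^ (2 * e) - 60 * (p : ℤ) ^ (2 * e - 1)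
        + 98 * (p : ℤ) ^ (2 * e - 2) := by
  obtain ⟨m, rfl⟩ := Nat.exists_eq_add_of_le' he
  have h := theta_prime_pow_succ m hp hp5 hmod
  rw [← @Nat.cast_inj ℤ] at h
  push_cast [Nat.cast_sub (show 1 ≤ p by omega), Nat.cast_sub (show 2 ≤ p by omega),
    Nat.cast_sub (show 3 ≤ p by omega), Nat.cast_sub (show 4 ≤ p by omega),
    Nat.cast_sub hp5] at h
  rw [h, show 4 * (m + 1) - 1 = 4 * m + 3 by omega, show 4 * (m + 1) - 2 = 4 * m + 2 by omega,
    show 4 * (m + 1) - 3 = 4 * m + 1 by omega, show 4 * (m + 1) - 4 = 4 * m by omega,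
    show 2 * (m + 1) - 1 = 2 * m + 1 by omega, show 2 * (m + 1) - 2 = 2 * m by omega]
  ring
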